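/- arXiv:2301.08662 — 3 statements merged into one kernel-verified Lean document; each statement's English description precedes it below -/
import Mathlib

section
/- Let φ₀ : ℝ³ × ℝ³ × ℝ³ × ℝ³ → [0,2π) be a measurable function satisfying ‖Γ(v−z, φ) − Γ(v'−z', φ + φ₀(z,v,z',v'))‖ ≤ 3·‖(v−z) − (v'−z')‖ for all z,v,z',v' ∈ ℝ³ and φ ∈ ℝ. Then for all z, v, z', v' ∈ ℝ³, θ ∈ (0,π] and φ ∈ ℝ: ‖α(z,v,θ,φ) − α(z',v',θ, φ + φ₀(z,v,z',v'))‖ ≤ 2·θ·(‖z−z'‖ + ‖v−v'‖). -/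
open MeasureTheory Real Set Filter

noncomputable section

/-- Three-dimensional Euclidean space. -/
abbrev E3 : Type := EuclideanSpace ℝ (Fin 3)

open Classical in
/-- `Γ(X, φ) = cos φ · I(X) + sin φ · J(X)` (with `Γ(0, φ) := 0`). -/
def Gam (I J : E3 → E3) (X : E3) (φ : ℝ) : E3 :=
  if X = 0 then 0 else Real.cos φ • I X + Real.sin φ • J X

/-- The collision deflection `α(z,v,θ,φ) = sin²(θ/2)·(v−z) + (sin θ/2)·Γ(v−z, φ)`. -/
def alpha (I J : E3 → E3) (z v : E3) (θ φ : ℝ) : E3 :=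
  Real.sin (θ / 2) ^ 2 • (v - z) + (Real.sin θ / 2) • Gam I J (v - z) φ

/-- The Lipschitz estimate for the collision deflection `α` obtained from
Tanaka's rotation `φ₀` of the longitude angle. -/
theorem stmt_4 (I J : E3 → E3) (hI : Measurable I) (hJ : Measurable J)
    (hON : ∀ X : E3, X ≠ 0 →
      Orthonormal ℝ ![‖X‖⁻¹ • X, ‖X‖⁻¹ • I X, ‖X‖⁻¹ • J X])
    (φ₀ : E3 × E3 × E3 × E3 → ℝ) (hφ₀m : Measurable φ₀)
    (hφ₀r : ∀ p, φ₀ p ∈ Set.Ico 0 (2 * π))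
    (hφ₀ : ∀ z v z' v' : E3, ∀ φ : ℝ,
      ‖Gam I J (v - z) φ - Gam I J (v' - z') (φ + φ₀ (z, v, z', v'))‖ ≤
        3 * ‖(v - z) - (v' - z')‖) :
    ∀ z v z' v' : E3, ∀ θ ∈ Set.Ioc 0 π, ∀ φ : ℝ,
      ‖alpha I J z v θ φ - alpha I J z' v' θ (φ + φ₀ (z, v, z', v'))‖ ≤
        2 * θ * (‖z - z'‖ + ‖v - v'‖) := by
  intro z v z' v' θ hθ φ
  have hθ0 : 0 < θ := hθ.1
  have hsin : 0 ≤ Real.sin θ := Real.sin_nonneg_of_nonneg_of_le_pi hθ0.le hθ.2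
  have hsinθ : Real.sin θ ≤ θ := Real.sin_le hθ0.le
  have hhalf : Real.sin (θ / 2) ≤ θ / 2 := Real.sin_le (by positivity)
  have hhalf0 : 0 ≤ Real.sin (θ / 2) :=
    Real.sin_nonneg_of_nonneg_of_le_pi (by positivity) (by linarith [hθ.2])
  have hsq : Real.sin (θ / 2) ^ 2 ≤ θ / 2 := by
    nlinarith [Real.sin_le_one (θ / 2)]
  have hsub : ‖(v - z) - (v' - z')‖ ≤ ‖z - z'‖ + ‖v - v'‖ := by
    rw [sub_sub_sub_comm, add_comm]
    exact norm_sub_le _ _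
  calc ‖alpha I J z v θ φ - alpha I J z' v' θ (φ + φ₀ (z, v, z', v'))‖
      = ‖Real.sin (θ / 2) ^ 2 • ((v - z) - (v' - z')) + (Real.sin θ / 2) •
          (Gam I J (v - z) φ - Gam I J (v' - z') (φ + φ₀ (z, v, z', v')))‖ := by
        rw [alpha, alpha, add_sub_add_comm, ← smul_sub, ← smul_sub]
    _ ≤ Real.sin (θ / 2) ^ 2 * ‖(v - z) - (v' - z')‖ +
          Real.sin θ / 2 * (3 * ‖(v - z) - (v' - z')‖) := by
        refine (norm_add_le _ _).trans ?_
        rw [norm_smul, norm_smul, Real.norm_of_nonneg (sq_nonneg _),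
          Real.norm_of_nonneg (by positivity : 0 ≤ Real.sin θ / 2)]
        gcongr
        exact hφ₀ z v z' v' φ
    _ ≤ θ / 2 * ‖(v - z) - (v' - z')‖ + θ / 2 * (3 * ‖(v - z) - (v' - z')‖) := by
        gcongr
    _ = 2 * θ * ‖(v - z) - (v' - z')‖ := by ring
    _ ≤ 2 * θ * (‖z - z'‖ + ‖v - v'‖) := by gcongr
end
end

section
/- Fix θ ∈ (0,π]. For every continuous compactly supported function ψ : ℝ³ × ℝ³ × ℝ³ × ℝ³ → ℝ, the following change-of-variables identity holds: ∫_{ℝ³×ℝ³} ∫_[0,2π) ψ( z, v, z⋆(z,v,θ,φ), v⋆(z,v,θ,φ) ) dφ dz dv = ∫_{ℝ³×ℝ³} ∫_[0,2π) ψ( z⋆(z,v,θ,φ), v⋆(z,v,θ,φ), z, v ) dφ dz dv. -/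
open MeasureTheory Real Set Filter

noncomputable section

section PeriodicLIntegral

variable {T : ℝ} {g : ℝ → ENNReal}

lemma setLIntegral_Ioc_eq_of_periodic (hT : 0 < T) (hg : Function.Periodic g T) (s t : ℝ) :
    ∫⁻ x in Ioc s (s + T), g x = ∫⁻ x in Ioc t (t + T), g x := by
  refine (isAddFundamentalDomain_Ioc hT s).setLIntegral_eq (isAddFundamentalDomain_Ioc hT t) g ?_
  rintro ⟨_, n, rfl⟩ x
  have h := hg.zsmul n x
  simpa [AddSubgroup.vadd_def, add_comm] using h

lemma setLIntegral_Ico_comp_add_right (hT : 0 < T) (hg : Function.Periodic g T) (t : ℝ) :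
    ∫⁻ x in Ico 0 T, g (x + t) = ∫⁻ x in Ico 0 T, g x := by
  have h := (measurePreserving_add_right (volume : Measure ℝ) t).setLIntegral_comp_preimage_emb
    (measurableEmbedding_addRight t) g (Ioc t (t + T))
  have hpre : (fun x => x + t) ⁻¹' Ioc t (t + T) = Ioc 0 T := by ext; simp [add_comm]
  rw [hpre] at h
  rw [setLIntegral_congr Ico_ae_eq_Ioc, setLIntegral_congr Ico_ae_eq_Ioc, h,
    setLIntegral_Ioc_eq_of_periodic hT hg t 0, zero_add]

lemma setLIntegral_Ico_comp_neg (hT : 0 < T) (hg : Function.Periodic g T) :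
    ∫⁻ x in Ico 0 T, g (-x) = ∫⁻ x in Ico 0 T, g x := by
  have h := (Measure.measurePreserving_neg (volume : Measure ℝ)).setLIntegral_comp_preimage_emb
    (MeasurableEquiv.neg ℝ).measurableEmbedding g (Ioc (-T) (-T + T))
  have hpre : Neg.neg ⁻¹' Ioc (-T) (-T + T) = Ico (0 : ℝ) T := by ext; simp [and_comm]
  rw [hpre] at h
  rw [h, setLIntegral_congr Ico_ae_eq_Ioc, setLIntegral_Ioc_eq_of_periodic hT hg (-T) 0, zero_add]

end PeriodicLIntegral

lemma exists_cos_sin_eq {a b : ℝ} (h : a ^ 2 + b ^ 2 = 1) :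
    ∃ t, Real.cos t = a ∧ Real.sin t = b := by
  have hz : ‖(⟨a, b⟩ : ℂ)‖ = 1 := by
    rw [← sq_eq_sq₀ (norm_nonneg _) zero_le_one, Complex.sq_norm, Complex.normSq_apply]
    simpa [sq] using h
  have h0 : (⟨a, b⟩ : ℂ) ≠ 0 := norm_ne_zero_iff.mp (by simp [hz])
  exact ⟨Complex.arg ⟨a, b⟩, by simp [Complex.cos_arg h0, hz], by simp [Complex.sin_arg, hz]⟩

/-- The uniform measure on a circle does not depend on the orthogonal frame parametrizing it. -/
lemma lintegral_circle_eq_of_frame {E : Type*} [AddCommGroup E] [Module ℝ E] {a b c d : ℝ}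
    (hab : a ^ 2 + b ^ 2 = 1) (hcd : c ^ 2 + d ^ 2 = 1) (h : a * c + b * d = 0) (u w : E)
    (f : E → ENNReal) :
    ∫⁻ φ in Ico 0 (2 * π),
        f (Real.cos φ • (a • u + b • w) + Real.sin φ • (c • u + d • w)) =
      ∫⁻ φ in Ico 0 (2 * π), f (Real.cos φ • u + Real.sin φ • w) := by
  obtain ⟨t, rfl, rfl⟩ := exists_cos_sin_eq hab
  set g : ℝ → ENNReal := fun φ => f (Real.cos φ • u + Real.sin φ • w) with hg
  have hper : Function.Periodic g (2 * π) := fun x => by simp [hg]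
  have key : (c = -Real.sin t ∧ d = Real.cos t) ∨ (c = Real.sin t ∧ d = -Real.cos t) := by
    have hc : c = (c * -Real.sin t + d * Real.cos t) * -Real.sin t := by
      linear_combination (-c) * hab + Real.cos t * h
    have hd : d = (c * -Real.sin t + d * Real.cos t) * Real.cos t := by
      linear_combination (-d) * hab + Real.sin t * h
    have hs : (c * -Real.sin t + d * Real.cos t) ^ 2 = 1 := by
      linear_combination (Real.cos t ^ 2 + Real.sin t ^ 2) * hcd + hab
        - (Real.cos t * c + Real.sin t * d) * h
    rcases mul_self_eq_one_iff.mp ((sq _).symm.trans hs) with h1 | h1 <;> rw [h1] at hc hd <;> simp_all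
  rcases key with ⟨rfl, rfl⟩ | ⟨rfl, rfl⟩
  · rw [← setLIntegral_Ico_comp_add_right two_pi_pos hper t]
    refine lintegral_congr fun φ => ?_
    simp only [hg, Real.cos_add, Real.sin_add]
    congr 1
    module
  · have hper' : Function.Periodic (fun φ => g (-φ)) (2 * π) := fun x => by
      simp only [neg_add]
      exact hper.neg _
    rw [← setLIntegral_Ico_comp_neg two_pi_pos hper,
      ← setLIntegral_Ico_comp_add_right two_pi_pos hper' (-t)]
    refine lintegral_congr fun φ => ?_
    simp only [hg, Real.cos_neg, Real.sin_neg, Real.cos_add, Real.sin_add]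
    congr 1
    module

section UnitaryAverage

variable {E : Type*} [NormedAddCommGroup E] [InnerProductSpace ℝ E] [FiniteDimensional ℝ E]

instance continuousStar_continuousLinearMap : ContinuousStar (E →L[ℝ] E) :=
  ⟨(ContinuousLinearMap.adjoint (𝕜 := ℝ) (E := E) (F := E)).continuous⟩

instance compactSpace_unitary : CompactSpace (unitary (E →L[ℝ] E)) := by
  refine (isCompact_iff_compactSpace (s := (unitary (E →L[ℝ] E) : Set (E →L[ℝ] E)))).mp ?_
  refine (isCompact_closedBall (0 : E →L[ℝ] E) 1).of_isClosed_subset isClosed_unitary fun u hu => ?_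
  rw [mem_closedBall_zero_iff]
  exact u.opNorm_le_bound zero_le_one fun x => by
    rw [Unitary.norm_map ⟨u, hu⟩ x, one_mul]

variable [MeasurableSpace E] [BorelSpace E]

/-- A measure on pairs of vectors of equal norm that is invariant under the diagonal action of the
orthogonal group is symmetric. -/
lemma map_swap_eq_self_of_unitary_invariant (N : Measure (E × E)) [SFinite N]
    (hN : ∀ᵐ q ∂N, ‖q.1‖ = ‖q.2‖)
    (hinv : ∀ R : unitary (E →L[ℝ] E),
      N.map (fun q => ((R : E →L[ℝ] E) q.1, (R : E →L[ℝ] E) q.2)) = N) :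
    N.map Prod.swap = N := by
  obtain ⟨μ, hμ, hleft⟩ : ∃ μ : Measure (unitary (E →L[ℝ] E)),
      μ univ = 1 ∧ μ.IsMulLeftInvariant :=
    ⟨Measure.haarMeasure ⊤, Measure.haarMeasure_self, inferInstance⟩
  have : IsFiniteMeasure μ := ⟨by simp [hμ]⟩
  let A : unitary (E →L[ℝ] E) → E × E → E × E := fun R q =>
    (((R⁻¹ : unitary (E →L[ℝ] E)) : E →L[ℝ] E) q.1, ((R⁻¹ : unitary (E →L[ℝ] E)) : E →L[ℝ] E) q.2)
  have hA : Measurable fun p : (E × E) × unitary (E →L[ℝ] E) => A p.2 p.1 := by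
    refine Continuous.measurable ?_
    have hc : Continuous fun p : (E × E) × unitary (E →L[ℝ] E) =>
        ((p.2⁻¹ : unitary (E →L[ℝ] E)) : E →L[ℝ] E) :=
      continuous_subtype_val.comp (continuous_inv.comp continuous_snd)
    exact (hc.clm_apply (by fun_prop)).prodMk (hc.clm_apply (by fun_prop))
  have avg : ∀ f : E × E → ENNReal, Measurable f →
      ∫⁻ q, f q ∂N = ∫⁻ q, ∫⁻ R, f (A R q) ∂μ ∂N := by
    intro f hf
    have hfA : Measurable (Function.uncurry fun q R => f (A R q)) := hf.comp hA
    rw [lintegral_lintegral_swap hfA.aemeasurable]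
    have hconst : ∀ R, ∫⁻ q, f (A R q) ∂N = ∫⁻ q, f q ∂N := fun R => by
      conv_rhs => rw [← hinv R⁻¹]
      rw [lintegral_map hf (by fun_prop)]
    simp [hconst, hμ]
  refine Measure.ext_of_lintegral _ fun f hf => ?_
  rw [lintegral_map hf measurable_swap, avg f hf,
    avg (fun q => f q.swap) (hf.comp measurable_swap)]
  refine lintegral_congr_ae (hN.mono fun q hq => ?_)
  let s : E ≃ₗᵢ[ℝ] E := (Submodule.span ℝ {q.1 - q.2})ᗮ.reflection
  have hs : s q.1 = q.2 := Submodule.reflection_sub hq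
  have hs' : s q.2 = q.1 := hs ▸ Submodule.reflection_reflection _ q.1
  let S : unitary (E →L[ℝ] E) := Unitary.linearIsometryEquiv.symm s
  have hS : ∀ x, ((S : E →L[ℝ] E)) x = s x := fun x => rfl
  have hSS : S⁻¹ = S := by
    have hss : s * s = 1 := Submodule.reflection_mul_reflection _
    rw [inv_eq_iff_mul_eq_one, ← map_mul, hss, map_one]
  refine (lintegral_congr fun R => ?_).trans
    (lintegral_mul_left_eq_self (μ := μ) (fun R => f (A R q)) S)
  simp [A, mul_inv_rev, hSS, hS, hs, hs']

end UnitaryAverage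

section Frame

lemma exists_coeff_of_orthonormal {e₀ e₁ e₂ f₁ f₂ : E3} (he : Orthonormal ℝ ![e₀, e₁, e₂])
    (hf : Orthonormal ℝ ![e₀, f₁, f₂]) :
    ∃ a b c d : ℝ, f₁ = a • e₁ + b • e₂ ∧ f₂ = c • e₁ + d • e₂ ∧
      a ^ 2 + b ^ 2 = 1 ∧ c ^ 2 + d ^ 2 = 1 ∧ a * c + b * d = 0 := by
  let b₀ := basisOfOrthonormalOfCardEqFinrank he (by simp)
  have hb₀ : ⇑b₀ = ![e₀, e₁, e₂] := coe_basisOfOrthonormalOfCardEqFinrank he (by simp)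
  let b : OrthonormalBasis (Fin 3) ℝ E3 := b₀.toOrthonormalBasis (by rw [hb₀]; exact he)
  have hb : ⇑b = ![e₀, e₁, e₂] := by simp [b, hb₀]
  have h01 : inner ℝ e₀ f₁ = 0 := by simpa using hf.2 (i := 0) (j := 1) (by decide)
  have h02 : inner ℝ e₀ f₂ = 0 := by simpa using hf.2 (i := 0) (j := 2) (by decide)
  have h12 : inner ℝ f₁ f₂ = 0 := by simpa using hf.2 (i := 1) (j := 2) (by decide)
  have h1 : inner ℝ f₁ f₁ = 1 := by
    rw [real_inner_self_eq_norm_sq]; have := hf.1 1; simp_all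
  have h2 : inner ℝ f₂ f₂ = 1 := by
    rw [real_inner_self_eq_norm_sq]; have := hf.1 2; simp_all
  have p11 := b.sum_inner_mul_inner f₁ f₁
  have p22 := b.sum_inner_mul_inner f₂ f₂
  have p12 := b.sum_inner_mul_inner f₁ f₂
  have s1 := b.sum_repr' f₁
  have s2 := b.sum_repr' f₂
  simp only [hb, Fin.sum_univ_three, Matrix.cons_val_zero, Matrix.cons_val_one,
    Matrix.cons_val, h01, h02, h12, h1, h2, real_inner_comm e₀, real_inner_comm e₁,
    real_inner_comm e₂, zero_smul, zero_add, mul_zero] at p11 p22 p12 s1 s2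
  refine ⟨inner ℝ e₁ f₁, inner ℝ e₂ f₁, inner ℝ e₁ f₂, inner ℝ e₂ f₂, s1.symm, s2.symm, ?_, ?_, ?_⟩
  · rw [← p11, real_inner_comm f₁ e₁, real_inner_comm f₁ e₂]; ring
  · rw [← p22, real_inner_comm f₂ e₁, real_inner_comm f₂ e₂]; ring
  · rw [← p12, real_inner_comm f₁ e₁, real_inner_comm f₁ e₂]

variable {I J : E3 → E3}

lemma measurable_Gam (hI : Measurable I) (hJ : Measurable J) :
    Measurable fun q : E3 × ℝ => Gam I J q.1 q.2 := by
  unfold Gam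
  refine Measurable.ite (measurable_fst (measurableSet_singleton (0 : E3))) measurable_const ?_
  fun_prop

/-- The law of `Γ(X, φ)` for uniform `φ` is equivariant under isometries, even though the frame
`I`, `J` need not be. -/
lemma lintegral_Gam_map
    (hON : ∀ X : E3, X ≠ 0 →
      Orthonormal ℝ ![‖X‖⁻¹ • X, ‖X‖⁻¹ • I X, ‖X‖⁻¹ • J X])
    (R : E3 ≃ₗᵢ[ℝ] E3) (X : E3) (f : E3 → ENNReal) :
    ∫⁻ φ in Ico 0 (2 * π), f (Gam I J (R X) φ) =
      ∫⁻ φ in Ico 0 (2 * π), f (R (Gam I J X φ)) := by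
  by_cases hX : X = 0
  · simp [Gam, hX]
  have hRX : R X ≠ 0 := by simpa using hX
  have h1 := (hON X hX).comp_linearIsometryEquiv R
  have h2 := hON (R X) hRX
  have hcomp : R ∘ ![‖X‖⁻¹ • X, ‖X‖⁻¹ • I X, ‖X‖⁻¹ • J X] =
      ![‖X‖⁻¹ • R X, ‖X‖⁻¹ • R (I X), ‖X‖⁻¹ • R (J X)] := by
    ext i : 1
    fin_cases i <;> simp
  rw [hcomp] at h1
  rw [R.norm_map] at h2
  obtain ⟨a, b, c, d, hu, hw, hab, hcd, hac⟩ := exists_coeff_of_orthonormal h1 h2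
  have hr : ‖X‖⁻¹ ≠ 0 := inv_ne_zero (norm_ne_zero_iff.mpr hX)
  have hu' : I (R X) = a • R (I X) + b • R (J X) := by
    refine smul_right_injective E3 hr ?_
    simp only [hu, smul_add, smul_comm ‖X‖⁻¹]
  have hw' : J (R X) = c • R (I X) + d • R (J X) := by
    refine smul_right_injective E3 hr ?_
    simp only [hw, smul_add, smul_comm ‖X‖⁻¹]
  simp only [Gam, hX, hRX, if_false, hu', hw', map_add, map_smul]
  exact lintegral_circle_eq_of_frame hab hcd hac _ _ f

lemma norm_cos_smul_sub_sin_smul_Gam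
    (hON : ∀ X : E3, X ≠ 0 →
      Orthonormal ℝ ![‖X‖⁻¹ • X, ‖X‖⁻¹ • I X, ‖X‖⁻¹ • J X])
    (θ φ : ℝ) (X : E3) :
    ‖Real.cos θ • X - Real.sin θ • Gam I J X φ‖ = ‖X‖ := by
  by_cases hX : X = 0
  · simp [Gam, hX]
  have h := hON X hX
  have hr : ‖X‖ ≠ 0 := norm_ne_zero_iff.mpr hX
  have h01 : inner ℝ X (I X) = 0 := by
    simpa [inner_smul_left, inner_smul_right, hX] using h.2 (i := 0) (j := 1) (by decide)
  have h02 : inner ℝ X (J X) = 0 := by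
    simpa [inner_smul_left, inner_smul_right, hX] using h.2 (i := 0) (j := 2) (by decide)
  have h12 : inner ℝ (I X) (J X) = 0 := by
    simpa [inner_smul_left, inner_smul_right, hX] using h.2 (i := 1) (j := 2) (by decide)
  have h1 : ‖I X‖ = ‖X‖ := by
    have := h.1 1
    simp only [Matrix.cons_val_one, Matrix.cons_val_zero, norm_smul, norm_inv, norm_norm] at this
    field_simp at this
    exact this
  have h2 : ‖J X‖ = ‖X‖ := by
    have := h.1 2
    simp only [Matrix.cons_val, norm_smul, norm_inv, norm_norm] at this
    field_simp at this
    exact this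
  have h10 : inner ℝ (I X) X = 0 := by rw [real_inner_comm]; exact h01
  have h20 : inner ℝ (J X) X = 0 := by rw [real_inner_comm]; exact h02
  have h21 : inner ℝ (J X) (I X) = 0 := by rw [real_inner_comm]; exact h12
  rw [← sq_eq_sq₀ (norm_nonneg _) (norm_nonneg _)]
  simp only [Gam, hX, if_false]
  rw [← real_inner_self_eq_norm_sq]
  simp only [inner_sub_left, inner_sub_right, inner_add_left, inner_add_right, inner_smul_left,
    inner_smul_right, h01, h02, h12, h10, h20, h21,
    real_inner_self_eq_norm_sq, h1, h2, conj_trivial]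
  linear_combination ‖X‖ ^ 2 * Real.cos_sq_add_sin_sq θ +
    ‖X‖ ^ 2 * Real.sin θ ^ 2 * Real.cos_sq_add_sin_sq φ

end Frame

section Symmetry

lemma lintegral_prod_eq_center {E : Type*} [AddCommGroup E] [Module ℝ E] [MeasurableSpace E]
    [MeasurableAdd₂ E] [MeasurableSub₂ E] [MeasurableConstSMul ℝ E] (μ : Measure E) [SFinite μ]
    [μ.IsAddLeftInvariant] [μ.IsAddRightInvariant] {H : E × E → ENNReal} (hH : Measurable H) :
    ∫⁻ p, H p ∂(μ.prod μ) =
      ∫⁻ c, ∫⁻ X, H (c - (2⁻¹ : ℝ) • X, c + (2⁻¹ : ℝ) • X) ∂μ ∂μ := by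
  calc ∫⁻ p, H p ∂(μ.prod μ)
      = ∫⁻ z, ∫⁻ v, H (z, v) ∂μ ∂μ := lintegral_prod _ hH.aemeasurable
    _ = ∫⁻ z, ∫⁻ X, H (z, z + X) ∂μ ∂μ :=
      lintegral_congr fun z => (lintegral_add_left_eq_self (fun v => H (z, v)) z).symm
    _ = ∫⁻ X, ∫⁻ z, H (z, z + X) ∂μ ∂μ := by
      refine lintegral_lintegral_swap (f := fun z X => H (z, z + X)) (Measurable.aemeasurable ?_)
      exact hH.comp (by fun_prop)
    _ = ∫⁻ X, ∫⁻ c, H (c - (2⁻¹ : ℝ) • X, c + (2⁻¹ : ℝ) • X) ∂μ ∂μ := by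
      refine lintegral_congr fun X => ?_
      rw [← lintegral_sub_right_eq_self _ ((2⁻¹ : ℝ) • X)]
      refine lintegral_congr fun c => ?_
      congr 2
      module
    _ = ∫⁻ c, ∫⁻ X, H (c - (2⁻¹ : ℝ) • X, c + (2⁻¹ : ℝ) • X) ∂μ ∂μ := by
      refine lintegral_lintegral_swap
        (f := fun X c => H (c - (2⁻¹ : ℝ) • X, c + (2⁻¹ : ℝ) • X)) (Measurable.aemeasurable ?_)
      exact hH.comp (by fun_prop)

variable {I J : E3 → E3}

/-- Tanaka's symmetry for the relative velocity `X` and its image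
`cos θ • X - sin θ • Γ(X, φ)`. -/
lemma lintegral_relative_velocity_symm (hI : Measurable I) (hJ : Measurable J)
    (hON : ∀ X : E3, X ≠ 0 →
      Orthonormal ℝ ![‖X‖⁻¹ • X, ‖X‖⁻¹ • I X, ‖X‖⁻¹ • J X])
    (θ : ℝ) {F : E3 × E3 → ENNReal} (hF : Measurable F) :
    ∫⁻ X, ∫⁻ φ in Ico 0 (2 * π), F (X, Real.cos θ • X - Real.sin θ • Gam I J X φ) =
      ∫⁻ X, ∫⁻ φ in Ico 0 (2 * π), F (Real.cos θ • X - Real.sin θ • Gam I J X φ, X) := by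
  have hGam := measurable_Gam hI hJ
  let g : E3 × ℝ → E3 × E3 := fun q => (q.1, Real.cos θ • q.1 - Real.sin θ • Gam I J q.1 q.2)
  have hg : Measurable g :=
    measurable_fst.prodMk ((measurable_fst.const_smul (Real.cos θ)).sub
      (hGam.const_smul (Real.sin θ)))
  let N : Measure (E3 × E3) :=
    ((volume : Measure E3).prod (volume.restrict (Ico 0 (2 * π)))).map g
  have hN : ∀ f : E3 × E3 → ENNReal, Measurable f → ∫⁻ q, f q ∂N =
      ∫⁻ X, ∫⁻ φ in Ico 0 (2 * π), f (X, Real.cos θ • X - Real.sin θ • Gam I J X φ) := by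
    intro f hf
    rw [lintegral_map hf hg, lintegral_prod (fun q => f (g q)) (hf.comp hg).aemeasurable]
  have hnorm : ∀ᵐ q ∂N, ‖q.1‖ = ‖q.2‖ := by
    rw [ae_map_iff hg.aemeasurable (measurableSet_eq_fun (by fun_prop) (by fun_prop))]
    exact Eventually.of_forall fun q => (norm_cos_smul_sub_sin_smul_Gam hON θ q.2 q.1).symm
  have hinv : ∀ R : unitary (E3 →L[ℝ] E3),
      N.map (fun q => ((R : E3 →L[ℝ] E3) q.1, (R : E3 →L[ℝ] E3) q.2)) = N := by
    intro R
    let r : E3 ≃ₗᵢ[ℝ] E3 := Unitary.linearIsometryEquiv R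
    have hr : Measurable fun q : E3 × E3 => (r q.1, r q.2) :=
      Continuous.measurable (by fun_prop)
    change N.map (fun q => (r q.1, r q.2)) = N
    refine Measure.ext_of_lintegral _ fun f hf => ?_
    rw [lintegral_map hf hr, hN (fun q => f (r q.1, r q.2)) (hf.comp hr), hN f hf]
    have hmeas : Measurable fun X => ∫⁻ φ in Ico 0 (2 * π), f (g (X, φ)) :=
      Measurable.lintegral_prod_right' (f := fun q => f (g q)) (hf.comp hg)
    refine Eq.trans (lintegral_congr fun X => ?_) (r.measurePreserving.lintegral_comp hmeas)
    simp only [map_sub, map_smul]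
    exact (lintegral_Gam_map hON r X
      fun Y => f (r X, Real.cos θ • r X - Real.sin θ • Y)).symm
  have hswap := map_swap_eq_self_of_unitary_invariant N hnorm hinv
  rw [← hN F hF]
  conv_lhs => rw [← hswap]
  rw [lintegral_map hF measurable_swap]
  exact hN (fun q => F q.swap) (hF.comp measurable_swap)

lemma alpha_center (I J : E3 → E3) (c X : E3) (θ φ : ℝ) :
    c - (2⁻¹ : ℝ) • X + alpha I J (c - (2⁻¹ : ℝ) • X) (c + (2⁻¹ : ℝ) • X) θ φ =
        c - (2⁻¹ : ℝ) • (Real.cos θ • X - Real.sin θ • Gam I J X φ) ∧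
      c + (2⁻¹ : ℝ) • X - alpha I J (c - (2⁻¹ : ℝ) • X) (c + (2⁻¹ : ℝ) • X) θ φ =
        c + (2⁻¹ : ℝ) • (Real.cos θ • X - Real.sin θ • Gam I J X φ) := by
  have hX : c + (2⁻¹ : ℝ) • X - (c - (2⁻¹ : ℝ) • X) = X := by module
  have hcos : Real.cos θ = 1 - 2 * Real.sin (θ / 2) ^ 2 := by
    have h := Real.cos_two_mul (θ / 2)
    rw [show 2 * (θ / 2) = θ by ring] at h
    linear_combination h + 2 * Real.sin_sq_add_cos_sq (θ / 2)
  rw [alpha, hX, hcos]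
  constructor <;> module

lemma measurable_alpha {I J : E3 → E3} (hI : Measurable I) (hJ : Measurable J) (θ : ℝ) :
    Measurable fun q : (E3 × E3) × ℝ => alpha I J q.1.1 q.1.2 θ q.2 := by
  have hsub : Measurable fun q : (E3 × E3) × ℝ => q.1.2 - q.1.1 := by fun_prop
  exact (hsub.const_smul (Real.sin (θ / 2) ^ 2)).add
    (((measurable_Gam hI hJ).comp (hsub.prodMk measurable_snd)).const_smul (Real.sin θ / 2))

lemma lintegral_collision_symm (hI : Measurable I) (hJ : Measurable J)
    (hON : ∀ X : E3, X ≠ 0 →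
      Orthonormal ℝ ![‖X‖⁻¹ • X, ‖X‖⁻¹ • I X, ‖X‖⁻¹ • J X])
    (θ : ℝ) {F : E3 × E3 × E3 × E3 → ENNReal} (hF : Measurable F) :
    ∫⁻ p : E3 × E3, ∫⁻ φ in Ico 0 (2 * π),
        F (p.1, p.2, p.1 + alpha I J p.1 p.2 θ φ, p.2 - alpha I J p.1 p.2 θ φ) =
      ∫⁻ p : E3 × E3, ∫⁻ φ in Ico 0 (2 * π),
        F (p.1 + alpha I J p.1 p.2 θ φ, p.2 - alpha I J p.1 p.2 θ φ, p.1, p.2) := by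
  have ha := measurable_alpha hI hJ θ
  have h1 : Measurable fun p : E3 × E3 => ∫⁻ φ in Ico 0 (2 * π),
      F (p.1, p.2, p.1 + alpha I J p.1 p.2 θ φ, p.2 - alpha I J p.1 p.2 θ φ) :=
    Measurable.lintegral_prod_right' (f := fun q : (E3 × E3) × ℝ => F (q.1.1, q.1.2,
      q.1.1 + alpha I J q.1.1 q.1.2 θ q.2, q.1.2 - alpha I J q.1.1 q.1.2 θ q.2))
      (hF.comp (by fun_prop))
  have h2 : Measurable fun p : E3 × E3 => ∫⁻ φ in Ico 0 (2 * π),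
      F (p.1 + alpha I J p.1 p.2 θ φ, p.2 - alpha I J p.1 p.2 θ φ, p.1, p.2) :=
    Measurable.lintegral_prod_right' (f := fun q : (E3 × E3) × ℝ =>
      F (q.1.1 + alpha I J q.1.1 q.1.2 θ q.2, q.1.2 - alpha I J q.1.1 q.1.2 θ q.2,
        q.1.1, q.1.2)) (hF.comp (by fun_prop))
  rw [Measure.volume_eq_prod, lintegral_prod_eq_center _ h1, lintegral_prod_eq_center _ h2]
  refine lintegral_congr fun c => ?_
  simp only [(alpha_center I J c _ θ _).1, (alpha_center I J c _ θ _).2]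
  exact lintegral_relative_velocity_symm hI hJ hON θ
    (F := fun q => F (c - (2⁻¹ : ℝ) • q.1, c + (2⁻¹ : ℝ) • q.1,
      c - (2⁻¹ : ℝ) • q.2, c + (2⁻¹ : ℝ) • q.2)) (hF.comp (by fun_prop))

end Symmetry

/-- Tanaka's symmetry identity (Proposition 1.2): for fixed `θ`,
the change of variables `(z, v) ↦ (z⋆, v⋆)` leaves the integral invariant. -/
theorem stmt_8 (I J : E3 → E3) (hI : Measurable I) (hJ : Measurable J)
    (hON : ∀ X : E3, X ≠ 0 →
      Orthonormal ℝ ![‖X‖⁻¹ • X, ‖X‖⁻¹ • I X, ‖X‖⁻¹ • J X])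
    (θ : ℝ) (hθ : θ ∈ Set.Ioc 0 π)
    (ψ : E3 × E3 × E3 × E3 → ℝ) (hψc : Continuous ψ) (hψs : HasCompactSupport ψ) :
    ∫ p : E3 × E3, ∫ φ in Set.Ico 0 (2 * π),
        ψ (p.1, p.2, p.1 + alpha I J p.1 p.2 θ φ, p.2 - alpha I J p.1 p.2 θ φ) =
      ∫ p : E3 × E3, ∫ φ in Set.Ico 0 (2 * π),
        ψ (p.1 + alpha I J p.1 p.2 θ φ, p.2 - alpha I J p.1 p.2 θ φ, p.1, p.2) := by
  let m : Measure ((E3 × E3) × ℝ) := (volume : Measure (E3 × E3)).prod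
    (volume.restrict (Ico 0 (2 * π)))
  let g : (E3 × E3) × ℝ → E3 × E3 × E3 × E3 := fun q => (q.1.1, q.1.2,
    q.1.1 + alpha I J q.1.1 q.1.2 θ q.2, q.1.2 - alpha I J q.1.1 q.1.2 θ q.2)
  let σ : E3 × E3 × E3 × E3 → E3 × E3 × E3 × E3 := fun x => (x.2.2.1, x.2.2.2, x.1, x.2.1)
  have ha := measurable_alpha hI hJ θ
  have hg : Measurable g := by fun_prop
  have hσ : Continuous σ := by fun_prop
  have hsymm : m.map (σ ∘ g) = m.map g := by
    refine Measure.ext_of_lintegral _ fun F hF => ?_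
    rw [lintegral_map hF (hσ.measurable.comp hg), lintegral_map hF hg,
      lintegral_prod (fun q => F ((σ ∘ g) q)) (hF.comp (hσ.measurable.comp hg)).aemeasurable,
      lintegral_prod (fun q => F (g q)) (hF.comp hg).aemeasurable]
    exact (lintegral_collision_symm hI hJ hON θ hF).symm
  have hint : Integrable (ψ ∘ g) m := by
    let K : Set (E3 × E3) := (fun x : E3 × E3 × E3 × E3 => (x.1, x.2.1)) '' tsupport ψ
    have hK : IsCompact K := hψs.isCompact.image (by fun_prop)
    obtain ⟨C, hC⟩ := hψs.exists_bound_of_continuous hψc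
    have hfin : m (K ×ˢ univ) < ⊤ := by
      rw [Measure.prod_prod]
      exact ENNReal.mul_lt_top hK.measure_lt_top (by simp [ENNReal.mul_lt_top])
    have hbound : Integrable ((K ×ˢ univ).indicator fun _ => C) m :=
      (integrable_indicator_iff (hK.measurableSet.prod MeasurableSet.univ)).mpr
        (integrableOn_const hfin.ne)
    refine hbound.mono' (hψc.measurable.comp hg).aestronglyMeasurable
      (Eventually.of_forall fun q => ?_)
    by_cases hq : ψ (g q) = 0
    · simp only [Function.comp_apply, hq, norm_zero]
      exact indicator_nonneg (fun _ _ => (norm_nonneg _).trans (hC 0)) q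
    · have hmem : q ∈ K ×ˢ (univ : Set ℝ) := ⟨⟨g q, subset_tsupport ψ hq, rfl⟩, trivial⟩
      rw [indicator_of_mem hmem]
      exact hC _
  have hint' : Integrable (ψ ∘ (σ ∘ g)) m := by
    rw [← integrable_map_measure hψc.aestronglyMeasurable (hσ.measurable.comp hg).aemeasurable,
      hsymm]
    exact (integrable_map_measure hψc.aestronglyMeasurable hg.aemeasurable).mpr hint
  have h := integral_map (μ := m) hg.aemeasurable hψc.aestronglyMeasurable
  have h' := integral_map (μ := m) (hσ.measurable.comp hg).aemeasurable hψc.aestronglyMeasurable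
  rw [hsymm, h] at h'
  exact (integral_prod _ hint).symm.trans (h'.trans (integral_prod _ hint'))
end
end

section
/- Let μ be a finite Borel measure on ℝ³ × ℝ³ and let f : ℝ³ × ℝ³ → [0,∞) be measurable with ∫_{ℝ⁶} ∫_{ℝ³} (1 + ‖z‖ + ‖v‖)^{2+γ} f(x,v) dv μ(d(x,z)) < ∞. Then ∫_{ℝ⁶} ∫_{ℝ³} ∫_(0,π] ∫_[0,2π) ( ‖z + α(z,v,θ,φ)‖² − ‖z‖² ) σ(‖z−v‖) f(x,v) dφ Q(dθ) dv μ(d(x,z)) = − ∫_{ℝ⁶} ∫_{ℝ³} ∫_(0,π] ∫_[0,2π) ( ‖z‖² − ‖v‖² ) sin²(θ/2) σ(‖z−v‖) f(x,v) dφ Q(dθ) dv μ(d(x,z)). -/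
open MeasureTheory Real Set Filter

noncomputable section

open scoped RealInnerProductSpace in
/-- The vector `Γ(X, φ)` is orthogonal to `X`. -/
lemma inner_self_Gam {I J : E3 → E3}
    (hON : ∀ X : E3, X ≠ 0 → Orthonormal ℝ ![‖X‖⁻¹ • X, ‖X‖⁻¹ • I X, ‖X‖⁻¹ • J X])
    (X : E3) (φ : ℝ) : ⟪X, Gam I J X φ⟫ = 0 := by
  by_cases hX : X = 0
  · simp [hX]
  have hn : ‖X‖ ≠ 0 := norm_ne_zero_iff.2 hX
  have hXI : ⟪X, I X⟫ = 0 := by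
    simpa [inner_smul_left, inner_smul_right, hn, hX] using
      (hON X hX).2 (show (0 : Fin 3) ≠ 1 by decide)
  have hXJ : ⟪X, J X⟫ = 0 := by
    simpa [inner_smul_left, inner_smul_right, hn, hX] using
      (hON X hX).2 (show (0 : Fin 3) ≠ 2 by decide)
  simp [Gam, hX, inner_add_right, inner_smul_right, hXI, hXJ]

open scoped RealInnerProductSpace in
/-- The vector `Γ(X, φ)` has the same norm as `X`. -/
lemma norm_Gam_sq {I J : E3 → E3}
    (hON : ∀ X : E3, X ≠ 0 → Orthonormal ℝ ![‖X‖⁻¹ • X, ‖X‖⁻¹ • I X, ‖X‖⁻¹ • J X])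
    (X : E3) (φ : ℝ) : ‖Gam I J X φ‖ ^ 2 = ‖X‖ ^ 2 := by
  by_cases hX : X = 0
  · simp [Gam, hX]
  have hn : ‖X‖ ≠ 0 := norm_ne_zero_iff.2 hX
  have hIJ : ⟪I X, J X⟫ = 0 := by
    simpa [inner_smul_left, inner_smul_right, hn, hX] using
      (hON X hX).2 (show (1 : Fin 3) ≠ 2 by decide)
  have hI : ‖I X‖ = ‖X‖ := by
    have h : ‖‖X‖⁻¹ • I X‖ = 1 := (hON X hX).1 1
    rw [norm_smul, norm_inv, norm_norm] at h
    field_simp at h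
    exact h
  have hJ : ‖J X‖ = ‖X‖ := by
    have h : ‖‖X‖⁻¹ • J X‖ = 1 := (hON X hX).1 2
    rw [norm_smul, norm_inv, norm_norm] at h
    field_simp at h
    exact h
  rw [Gam, if_neg hX, norm_add_sq_real, inner_smul_left, inner_smul_right, hIJ, norm_smul,
    norm_smul, hI, hJ, mul_pow, mul_pow, Real.norm_eq_abs, Real.norm_eq_abs, sq_abs, sq_abs]
  linear_combination ‖X‖ ^ 2 * Real.sin_sq_add_cos_sq φ

open scoped RealInnerProductSpace in
/-- Energy gained by the first particle in a collision. -/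
lemma norm_add_alpha_sq_sub {I J : E3 → E3}
    (hON : ∀ X : E3, X ≠ 0 → Orthonormal ℝ ![‖X‖⁻¹ • X, ‖X‖⁻¹ • I X, ‖X‖⁻¹ • J X])
    (z v : E3) (θ φ : ℝ) :
    ‖z + alpha I J z v θ φ‖ ^ 2 - ‖z‖ ^ 2 =
      -((‖z‖ ^ 2 - ‖v‖ ^ 2) * Real.sin (θ / 2) ^ 2) +
        Real.sin θ * ⟪z, Gam I J (v - z) φ⟫ := by
  have hsin : Real.sin θ = 2 * Real.sin (θ / 2) * Real.cos (θ / 2) := by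
    rw [← Real.sin_two_mul, mul_div_cancel₀ θ two_ne_zero]
  have hv : ‖v‖ ^ 2 = ‖z‖ ^ 2 + 2 * ⟪z, v - z⟫ + ‖v - z‖ ^ 2 := by
    rw [← norm_add_sq_real, add_sub_cancel]
  have hα : ‖alpha I J z v θ φ‖ ^ 2 = Real.sin (θ / 2) ^ 2 * ‖v - z‖ ^ 2 := by
    rw [alpha, norm_add_sq_real, inner_smul_left, inner_smul_right, inner_self_Gam hON,
      norm_smul, norm_smul, mul_pow, mul_pow, norm_Gam_sq hON, Real.norm_eq_abs,
      Real.norm_eq_abs, sq_abs, sq_abs, hsin]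
    linear_combination
      Real.sin (θ / 2) ^ 2 * ‖v - z‖ ^ 2 * Real.sin_sq_add_cos_sq (θ / 2)
  rw [norm_add_sq_real, hα, hv, alpha, inner_add_right, inner_smul_right, inner_smul_right]
  ring

open scoped RealInnerProductSpace in
lemma inner_Gam (I J : E3 → E3) (z X : E3) :
    ∃ a b : ℝ, ∀ φ, ⟪z, Gam I J X φ⟫ = a * Real.cos φ + b * Real.sin φ := by
  by_cases hX : X = 0
  · exact ⟨0, 0, fun φ => by simp [Gam, hX]⟩
  · refine ⟨⟪z, I X⟫, ⟪z, J X⟫, fun φ => ?_⟩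
    simp only [Gam, if_neg hX, inner_add_right, inner_smul_right]
    ring

/-- Trigonometric polynomials of degree one have mean value equal to their constant term. -/
lemma setIntegral_Ico_const_add_cos_add_sin (k a b : ℝ) :
    ∫ φ in Set.Ico 0 (2 * π), (k + (a * Real.cos φ + b * Real.sin φ)) =
      ∫ _ in Set.Ico 0 (2 * π), k := by
  have hab : ∫ φ in Set.Ico 0 (2 * π), (a * Real.cos φ + b * Real.sin φ) = 0 := by
    rw [integral_Ico_eq_integral_Ioc, ← intervalIntegral.integral_of_le (by positivity),
      intervalIntegral.integral_add
        (Continuous.intervalIntegrable (by fun_prop) _ _)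
        (Continuous.intervalIntegrable (by fun_prop) _ _)]
    simp
  rw [integral_add (integrable_const k)
    ((Continuous.integrableOn_Icc (by fun_prop)).mono_set Set.Ico_subset_Icc_self),
    hab, add_zero]

/-- Energy-dissipation identity for the bilinear collision operator:
`Q(f,μ)(‖z‖²) = −∫∫∫∫ (‖z‖²−‖v‖²) sin²(θ/2) σ(‖z−v‖) f(x,v) dφ Q(dθ) dv μ(dx,dz)`. -/
theorem stmt_13
    (I J : E3 → E3) (hI : Measurable I) (hJ : Measurable J)
    (hON : ∀ X : E3, X ≠ 0 →
      Orthonormal ℝ ![‖X‖⁻¹ • X, ‖X‖⁻¹ • I X, ‖X‖⁻¹ • J X])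
    (Q : Measure ℝ) [SigmaFinite Q]
    (hQ : ∫⁻ θ in Set.Ioc 0 π, ENNReal.ofReal θ ∂Q ≠ ⊤)
    (c γ : ℝ) (hc : 0 < c) (hγ : γ ∈ Set.Ioc (-1 : ℝ) 1)
    (μ : Measure (E3 × E3)) [IsFiniteMeasure μ]
    (f : E3 → E3 → ℝ)
    (hfm : Measurable (fun p : E3 × E3 => f p.1 p.2))
    (hf0 : ∀ x v, 0 ≤ f x v)
    (hmom : Integrable (fun q : (E3 × E3) × E3 =>
        (1 + ‖q.1.2‖ + ‖q.2‖) ^ ((2 : ℝ) + γ) * f q.1.1 q.2)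
      (μ.prod (volume : Measure E3))) :
    ∫ p : E3 × E3,
        (∫ v : E3, ∫ θ in Set.Ioc 0 π, ∫ φ in Set.Ico 0 (2 * π),
          (‖p.2 + alpha I J p.2 v θ φ‖ ^ 2 - ‖p.2‖ ^ 2) * (c * ‖p.2 - v‖ ^ γ) * f p.1 v
          ∂volume ∂Q ∂volume) ∂μ =
      - ∫ p : E3 × E3,
          (∫ v : E3, ∫ θ in Set.Ioc 0 π, ∫ φ in Set.Ico 0 (2 * π),
            (‖p.2‖ ^ 2 - ‖v‖ ^ 2) * Real.sin (θ / 2) ^ 2 * (c * ‖p.2 - v‖ ^ γ) * f p.1 v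
            ∂volume ∂Q ∂volume) ∂μ := by
  rw [← integral_neg]
  refine integral_congr_ae (ae_of_all _ fun p => ?_)
  beta_reduce
  rw [← integral_neg]
  refine integral_congr_ae (ae_of_all _ fun v => ?_)
  beta_reduce
  rw [← integral_neg]
  refine integral_congr_ae (ae_of_all _ fun θ => ?_)
  beta_reduce
  rw [← integral_neg]
  obtain ⟨a, b, hab⟩ := inner_Gam I J p.2 (v - p.2)
  rw [← setIntegral_Ico_const_add_cos_add_sin _
    (Real.sin θ * (c * ‖p.2 - v‖ ^ γ) * f p.1 v * a)
    (Real.sin θ * (c * ‖p.2 - v‖ ^ γ) * f p.1 v * b)]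
  refine integral_congr_ae (ae_of_all _ fun φ => ?_)
  beta_reduce
  rw [norm_add_alpha_sq_sub hON, hab]
  ring
end
end
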